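/- Let Ω ⊂ ℝⁿ be a domain and D ⊂ ∂Ω closed. Suppose the D-adapted fractional Hardy inequality holds: for all f in the Gagliardo space W^{s,p}(Ω) (intrinsic norm), ∫_Ω |f(x)|^p / dist(x,D)^{sp} dx ≤ C ‖f‖^p_{W^{s,p}(Ω)}. Then for f in this space, defining f_m := (1 − v_m) f with v_m the cutoff equal to 1 on {dist(·,D) ≤ 1/m}, supported in {dist(·,D) ≤ 2/m}, and m-Lipschitz, one has f_m → f in the intrinsic Gagliardo norm as m → ∞; in particular every such f is approximable by functions whose support has positive distance to D. -/

import Mathlib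

open Metric Set MeasureTheory Filter
open scoped ENNReal

/-- The intrinsic (Gagliardo) fractional Sobolev norm on `Ω`. -/
noncomputable def gagNorm (n : ℕ) (s p : ℝ) (Ω : Set (EuclideanSpace ℝ (Fin n)))
    (f : EuclideanSpace ℝ (Fin n) → ℝ) : ℝ≥0∞ :=
  (∫⁻ x in Ω, ENNReal.ofReal (|f x| ^ p)) ^ (1 / p) +
    (∫⁻ x in Ω, ∫⁻ y in Ω,
      ENNReal.ofReal (|f x - f y| ^ p / dist x y ^ ((n : ℝ) + s * p))) ^ (1 / p)


lemma aux_J (n : ℕ) (hn : n ≠ 0) (s p : ℝ) (hs : s ∈ Set.Ioo (0:ℝ) 1) (hp : 1 ≤ p) :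
    ∫⁻ u : EuclideanSpace ℝ (Fin n),
      ENNReal.ofReal ((min 1 (4 * ‖u‖)) ^ p / ‖u‖ ^ ((n:ℝ) + s * p)) ≠ ⊤ := by
  obtain ⟨hs0, hs1⟩ := hs
  have : Nonempty (Fin n) := ⟨⟨0, Nat.pos_of_ne_zero hn⟩⟩
  have key : Integrable (fun u : EuclideanSpace ℝ (Fin n) =>
      (fun r : ℝ => (min 1 (4 * r)) ^ p / r ^ ((n:ℝ) + s * p)) ‖u‖) volume := by
    refine (integrable_fun_norm_addHaar (volume : Measure (EuclideanSpace ℝ (Fin n)))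
      (f := fun r : ℝ => (min 1 (4 * r)) ^ p / r ^ ((n:ℝ) + s * p))).2 ?_
    have hm : ∀ S : Set ℝ, AEStronglyMeasurable (fun y : ℝ => y ^ (Module.finrank ℝ (EuclideanSpace ℝ (Fin n)) - 1) •
        ((min 1 (4 * y)) ^ p / y ^ ((n:ℝ) + s * p))) (volume.restrict S) := by
      intro S
      apply Measurable.aestronglyMeasurable
      simp only [smul_eq_mul]
      fun_prop
    have hsplit : Ioi (0:ℝ) = Ioo 0 2 ∪ Ioi 1 := by
      ext x; simp only [mem_Ioi, mem_union, mem_Ioo]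
      constructor
      · intro h; by_cases h2 : x < 2
        · exact Or.inl ⟨h, h2⟩
        · right; linarith
      · rintro (h | h)
        · exact h.1
        · linarith
    have hpow : ∀ y : ℝ, 0 < y → y ^ (n - 1) / y ^ ((n:ℝ) + s * p) = y ^ (-1 - s * p) := by
      intro y hy
      rw [← Real.rpow_natCast, ← Real.rpow_sub hy, Nat.cast_sub (Nat.one_le_iff_ne_zero.2 hn)]
      congr 1; push_cast; ring
    have hsp : 0 < s * p := by positivity
    have hsp' : s * p < p := by nlinarith
    rw [hsplit]
    apply IntegrableOn.union
    · have h1 : IntegrableOn (fun y : ℝ => 4 ^ p * y ^ (p - 1 - s * p)) (Ioo 0 2) :=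
        ((intervalIntegral.integrableOn_Ioo_rpow_iff (by norm_num)).2 (by linarith)).const_mul _
      refine Integrable.mono' h1 (hm _) ?_
      refine ae_restrict_of_forall_mem measurableSet_Ioo fun y hy => ?_
      have hy0 : 0 < y := hy.1
      rw [finrank_euclideanSpace_fin, smul_eq_mul, Real.norm_of_nonneg (by positivity), mul_div_assoc',
        mul_comm, mul_div_assoc, hpow y hy0]
      calc (min 1 (4 * y)) ^ p * y ^ (-1 - s * p) ≤ (4 * y) ^ p * y ^ (-1 - s * p) := by
            gcongr; exact min_le_right _ _
        _ = _ := by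
            rw [Real.mul_rpow (by norm_num) hy0.le, mul_assoc, ← Real.rpow_add hy0]
            congr 2; ring
    · have h1 : IntegrableOn (fun y : ℝ => y ^ (- 1 - s * p)) (Ioi 1) :=
        integrableOn_Ioi_rpow_of_lt (by linarith) one_pos
      refine Integrable.mono' h1 (hm _) ?_
      refine ae_restrict_of_forall_mem measurableSet_Ioi fun y hy => ?_
      have hy0 : 0 < y := one_pos.trans hy
      rw [finrank_euclideanSpace_fin, smul_eq_mul, Real.norm_of_nonneg (by positivity), mul_div_assoc',
        mul_comm, mul_div_assoc, hpow y hy0]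
      have : (min 1 (4 * y)) ^ p ≤ 1 := Real.rpow_le_one (by positivity) (min_le_left _ _) (by linarith)
      have h0 : 0 ≤ y ^ (-1 - s * p) := by positivity
      nlinarith
  exact key.lintegral_lt_top.ne

lemma aux_scale (n : ℕ) (s p d : ℝ) (hd : 0 < d) (x : EuclideanSpace ℝ (Fin n)) :
    ∫⁻ y : EuclideanSpace ℝ (Fin n),
      ENNReal.ofReal ((min 1 (4 * dist x y / d)) ^ p / dist x y ^ ((n:ℝ) + s * p)) =
    ENNReal.ofReal (1 / d ^ (s * p)) * ∫⁻ u : EuclideanSpace ℝ (Fin n),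
      ENNReal.ofReal ((min 1 (4 * ‖u‖)) ^ p / ‖u‖ ^ ((n:ℝ) + s * p)) := by
  set φ : EuclideanSpace ℝ (Fin n) → ℝ≥0∞ := fun u =>
    ENNReal.ofReal ((min 1 (4 * ‖u‖)) ^ p / ‖u‖ ^ ((n:ℝ) + s * p)) with hφ
  have hφm : Measurable φ := by fun_prop
  have h1 : ∀ y, ENNReal.ofReal ((min 1 (4 * dist x y / d)) ^ p / dist x y ^ ((n:ℝ) + s * p)) =
      (fun h => ENNReal.ofReal (d ^ (-((n:ℝ) + s * p))) * φ (d⁻¹ • h)) (x - y) := by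
    intro y
    simp only [hφ]
    rw [← ENNReal.ofReal_mul (by positivity), norm_smul, Real.norm_of_nonneg (by positivity), dist_eq_norm]
    congr 1
    rw [Real.mul_rpow (by positivity) (by positivity), Real.inv_rpow hd.le, Real.rpow_neg hd.le]
    have : d ^ ((n:ℝ) + s * p) ≠ 0 := by positivity
    have e : 4 * ‖x - y‖ / d = 4 * (d⁻¹ * ‖x - y‖) := by ring
    rw [e]
    generalize (min 1 (4 * (d⁻¹ * ‖x - y‖))) ^ p = A
    generalize d ^ ((n:ℝ) + s * p) = B at *
    generalize ‖x - y‖ ^ ((n:ℝ) + s * p) = E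
    rw [div_mul_eq_div_div, div_inv_eq_mul, mul_div_assoc', mul_comm A B, inv_mul_cancel_left₀ this]
  simp_rw [h1]
  rw [lintegral_sub_left_eq_self (μ := volume) (fun h => ENNReal.ofReal (d ^ (-((n:ℝ) + s * p))) * φ (d⁻¹ • h)) x]
  rw [lintegral_const_mul _ (by fun_prop)]
  have h2 : ∫⁻ h, φ (d⁻¹ • h) = ENNReal.ofReal (d ^ n) * ∫⁻ u, φ u := by
    rw [← lintegral_map (f := φ) (g := fun h => d⁻¹ • h) hφm (by fun_prop)]
    rw [show (fun h : EuclideanSpace ℝ (Fin n) => d⁻¹ • h) = (d⁻¹ • ·) from rfl, Measure.map_addHaar_smul _ (by positivity), lintegral_smul_measure, finrank_euclideanSpace_fin]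
    congr 2
    rw [inv_pow, inv_inv, abs_of_pos (by positivity)]
  rw [h2, ← mul_assoc, ← ENNReal.ofReal_mul (by positivity)]
  congr 2
  rw [← Real.rpow_natCast, ← Real.rpow_add hd, one_div, ← Real.rpow_neg hd.le]
  congr 1; ring

noncomputable def vv (m : ℕ) (t : ℝ) : ℝ := min 1 (max 0 (2 - (m : ℝ) * t))

lemma vv_nonneg (m : ℕ) (t : ℝ) : 0 ≤ vv m t := by unfold vv; positivity
lemma vv_le (m : ℕ) (t : ℝ) : vv m t ≤ 1 := min_le_left _ _

lemma vv_lip (m : ℕ) (a b : ℝ) : |vv m a - vv m b| ≤ m * |a - b| := by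
  unfold vv
  calc _ ≤ |max 0 (2 - (m : ℝ) * a) - max 0 (2 - (m : ℝ) * b)| := by
        have := abs_min_sub_min_le_max 1 (max 0 (2 - (m : ℝ) * a)) 1 (max 0 (2 - (m : ℝ) * b))
        simpa using this
    _ ≤ |(2 - (m : ℝ) * a) - (2 - (m : ℝ) * b)| := by
        have := abs_max_sub_max_le_max 0 (2 - (m : ℝ) * a) 0 (2 - (m : ℝ) * b)
        simpa using this
    _ = _ := by
        rw [show (2 - (m : ℝ) * a) - (2 - (m : ℝ) * b) = -(m * (a - b)) by ring, abs_neg, abs_mul, Nat.abs_cast]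

lemma vv_bound (m : ℕ) (a b r : ℝ) (ha : 0 < a) (hr : |a - b| ≤ r) :
    |vv m a - vv m b| ≤ min 1 (4 * r / a) := by
  have hr0 : 0 ≤ r := (abs_nonneg _).trans hr
  apply le_min
  · rw [abs_le]; have := vv_nonneg m a; have := vv_nonneg m b; have := vv_le m a; have := vv_le m b
    constructor <;> linarith
  rw [le_div_iff₀ ha]
  by_cases h : a ≤ 2 * r
  · have : |vv m a - vv m b| ≤ 1 := by
      rw [abs_le]; have := vv_nonneg m a; have := vv_nonneg m b; have := vv_le m a; have := vv_le m b
      constructor <;> linarith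
    nlinarith
  · push Not at h
    have hb : a / 2 < b := by have := (abs_le.1 hr).2; linarith
    by_cases hm : (m:ℝ) * a ≤ 4
    · have := vv_lip m a b
      have h3 : (m:ℝ) * |a - b| ≤ m * r := by gcongr
      calc |vv m a - vv m b| * a ≤ (m * r) * a := by gcongr; linarith
        _ = (m * a) * r := by ring
        _ ≤ _ := by gcongr
    · push Not at hm
      have hm0 : (0:ℝ) ≤ m := Nat.cast_nonneg m
      have z1 : vv m a = 0 := by
        unfold vv; rw [max_eq_left (by linarith)]; simp
      have z2 : vv m b = 0 := by
        unfold vv; rw [max_eq_left (by nlinarith)]; simp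
      rw [z1, z2]; simp; positivity

lemma vv_eventually (t : ℝ) (ht : 0 < t) : ∀ᶠ m : ℕ in atTop, vv m t = 0 := by
  obtain ⟨N, hN⟩ := exists_nat_ge (2 / t)
  filter_upwards [eventually_ge_atTop N] with m hm
  have h1 : (2 / t) ≤ m := hN.trans (by exact_mod_cast hm)
  rw [div_le_iff₀ ht] at h1
  unfold vv; rw [max_eq_left (by linarith)]; simp

lemma add_rpow_bound (p a b : ℝ) (hp : 1 ≤ p) (ha : 0 ≤ a) (hb : 0 ≤ b) :
    (a + b) ^ p ≤ 2 ^ (p-1) * (a ^ p + b ^ p) := by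
  have := NNReal.rpow_add_le_mul_rpow_add_rpow ⟨a, ha⟩ ⟨b, hb⟩ hp
  exact_mod_cast this

lemma aux_dom (p A B fx fy vx vy w K : ℝ) (hp : 1 ≤ p) (hA : |fx - fy| = A) (hv0 : 0 ≤ vy) (hv1 : vy ≤ 1)
    (hw : |vx - vy| ≤ w) (hB : |fx| = B) (hK : 0 ≤ K) :
    |vx * fx - vy * fy| ^ p / K ≤ 2 ^ (p-1) * (A ^ p / K + B ^ p * (w ^ p / K)) := by
  have hA0 : 0 ≤ A := hA ▸ abs_nonneg _
  have hB0 : 0 ≤ B := hB ▸ abs_nonneg _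
  have hw0 : 0 ≤ w := (abs_nonneg _).trans hw
  have h1 : |vx * fx - vy * fy| ≤ A + B * w := by
    rw [show vx * fx - vy * fy = vy * (fx - fy) + fx * (vx - vy) by ring]
    refine (abs_add_le _ _).trans ?_
    rw [abs_mul, abs_mul, hA, hB, abs_of_nonneg hv0]
    have : vy * A ≤ 1 * A := by gcongr
    have : B * |vx - vy| ≤ B * w := by gcongr
    linarith
  have h2 : |vx * fx - vy * fy| ^ p ≤ 2 ^ (p-1) * (A ^ p + B ^ p * w ^ p) := by
    rw [← Real.mul_rpow hB0 hw0]
    exact (Real.rpow_le_rpow (abs_nonneg _) h1 (by linarith)).trans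
      (add_rpow_bound p _ _ hp hA0 (by positivity))
  calc _ ≤ (2 ^ (p-1) * (A ^ p + B ^ p * w ^ p)) / K := by gcongr
    _ = _ := by ring

lemma main_tendsto {n : ℕ} (s p C₀ : ℝ) (hs : s ∈ Set.Ioo (0:ℝ) 1) (hp : 1 ≤ p)
    (Ω D : Set (EuclideanSpace ℝ (Fin n)))
    (hΩopen : IsOpen Ω) (hn : n ≠ 0)
    (hd : ∀ x ∈ Ω, 0 < infDist x D)
    (hardy : ∀ g : EuclideanSpace ℝ (Fin n) → ℝ, Measurable g →
      gagNorm n s p Ω g ≠ ⊤ →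
      ∫⁻ x in Ω, ENNReal.ofReal (|g x| ^ p / infDist x D ^ (s * p)) ≤
        ENNReal.ofReal C₀ * (gagNorm n s p Ω g) ^ p)
    (f : EuclideanSpace ℝ (Fin n) → ℝ) (hf : Measurable f)
    (hfin : gagNorm n s p Ω f ≠ ⊤) :
    Tendsto (fun m : ℕ => gagNorm n s p Ω
      (fun x => vv m (infDist x D) * f x)) atTop (nhds 0) := by
  have hp0 : 0 < p := by linarith
  have hΩm : MeasurableSet Ω := hΩopen.measurableSet
  have hvm : ∀ m : ℕ, Measurable (fun x : EuclideanSpace ℝ (Fin n) => vv m (infDist x D)) := by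
    intro m
    have := (continuous_infDist_pt D).measurable
    unfold vv
    fun_prop
  have hfin' := hfin
  unfold gagNorm at hfin'
  obtain ⟨hF1, hF2⟩ := ENNReal.add_ne_top.1 hfin'
  have hip : 0 < 1 / p := by positivity
  have hG1 : ∫⁻ x in Ω, ENNReal.ofReal (|f x| ^ p) ≠ ⊤ := by
    intro h; rw [h, ENNReal.top_rpow_of_pos hip] at hF1; exact hF1 rfl
  have hG2 : ∫⁻ x in Ω, ∫⁻ y in Ω,
      ENNReal.ofReal (|f x - f y| ^ p / dist x y ^ ((n : ℝ) + s * p)) ≠ ⊤ := by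
    intro h; rw [h, ENNReal.top_rpow_of_pos hip] at hF2; exact hF2 rfl
  have hH : ∫⁻ x in Ω, ENNReal.ofReal (|f x| ^ p / infDist x D ^ (s * p)) ≠ ⊤ :=
    ne_top_of_le_ne_top (ENNReal.mul_ne_top ENNReal.ofReal_ne_top
      (ENNReal.rpow_ne_top_of_nonneg hp0.le hfin)) (hardy f hf hfin)
  have hJ := aux_J n hn s p hs hp
  -- first part
  have T1 : Tendsto (fun m : ℕ => ∫⁻ x in Ω, ENNReal.ofReal (|vv m (infDist x D) * f x| ^ p))
      atTop (nhds 0) := by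
    have := tendsto_lintegral_of_dominated_convergence (μ := volume.restrict Ω)
      (F := fun (m : ℕ) x => ENNReal.ofReal (|vv m (infDist x D) * f x| ^ p)) (f := fun _ => 0)
      (fun x => ENNReal.ofReal (|f x| ^ p))
      (fun m => by have := hvm m; fun_prop) ?_ hG1 ?_
    · simpa using this
    · intro m
      refine Eventually.of_forall fun x => ?_
      refine ENNReal.ofReal_le_ofReal (Real.rpow_le_rpow (abs_nonneg _) ?_ hp0.le)
      rw [abs_mul, abs_of_nonneg (vv_nonneg _ _)]
      exact mul_le_of_le_one_left (abs_nonneg _) (vv_le _ _)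
    · refine ae_restrict_of_forall_mem hΩm fun x hx => ?_
      refine tendsto_const_nhds.congr' ?_
      filter_upwards [vv_eventually _ (hd x hx)] with m hm
      simp [hm, Real.zero_rpow hp0.ne']
  -- second part
  set μ : Measure (EuclideanSpace ℝ (Fin n)) := volume.restrict Ω with hμ
  have hdm : Measurable (fun x : EuclideanSpace ℝ (Fin n) => infDist x D) :=
    (continuous_infDist_pt D).measurable
  have mA : Measurable (fun z : EuclideanSpace ℝ (Fin n) × EuclideanSpace ℝ (Fin n) =>
      ENNReal.ofReal (|f z.1 - f z.2| ^ p / dist z.1 z.2 ^ ((n : ℝ) + s * p))) := by fun_prop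
  have mB : Measurable (fun z : EuclideanSpace ℝ (Fin n) × EuclideanSpace ℝ (Fin n) =>
      ENNReal.ofReal (|f z.1| ^ p * ((min 1 (4 * dist z.1 z.2 / infDist z.1 D)) ^ p /
        dist z.1 z.2 ^ ((n : ℝ) + s * p)))) := by fun_prop
  have hB : ∫⁻ x, ∫⁻ y, ENNReal.ofReal (|f x| ^ p * ((min 1 (4 * dist x y / infDist x D)) ^ p /
        dist x y ^ ((n : ℝ) + s * p))) ∂μ ∂μ ≠ ⊤ := by
    refine ne_top_of_le_ne_top (ENNReal.mul_ne_top hH hJ) ?_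
    rw [← lintegral_mul_const' _ _ hJ]
    refine lintegral_mono_ae ?_
    refine ae_restrict_of_forall_mem hΩm fun x hx => ?_
    have e : |f x| ^ p / infDist x D ^ (s * p) = |f x| ^ p * (1 / infDist x D ^ (s * p)) := by ring
    rw [e, ENNReal.ofReal_mul (by positivity), mul_assoc, ← aux_scale n s p _ (hd x hx) x,
      ← lintegral_const_mul' _ _ ENNReal.ofReal_ne_top]
    refine (lintegral_mono fun y => ?_).trans (lintegral_mono' (Measure.restrict_le_self (s := Ω)) le_rfl)
    rw [ENNReal.ofReal_mul (by positivity)]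
  have T2 : Tendsto (fun m : ℕ => ∫⁻ x in Ω, ∫⁻ y in Ω,
      ENNReal.ofReal (|vv m (infDist x D) * f x - vv m (infDist y D) * f y| ^ p /
        dist x y ^ ((n : ℝ) + s * p))) atTop (nhds 0) := by
    have mF : ∀ m : ℕ, Measurable (fun z : EuclideanSpace ℝ (Fin n) × EuclideanSpace ℝ (Fin n) =>
        ENNReal.ofReal (|vv m (infDist z.1 D) * f z.1 - vv m (infDist z.2 D) * f z.2| ^ p /
        dist z.1 z.2 ^ ((n : ℝ) + s * p))) := by
      intro m
      have h1 : Measurable (fun z : EuclideanSpace ℝ (Fin n) × EuclideanSpace ℝ (Fin n) => vv m (infDist z.1 D)) :=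
        (hvm m).comp measurable_fst
      have h2 : Measurable (fun z : EuclideanSpace ℝ (Fin n) × EuclideanSpace ℝ (Fin n) => vv m (infDist z.2 D)) :=
        (hvm m).comp measurable_snd
      fun_prop
    have hae : ∀ᵐ z ∂(μ.prod μ), z.1 ∈ Ω ∧ z.2 ∈ Ω := by
      rw [hμ, Measure.prod_restrict]
      exact ae_restrict_of_forall_mem (hΩm.prod hΩm) fun z hz => hz
    have := tendsto_lintegral_of_dominated_convergence (μ := μ.prod μ)
      (F := fun (m : ℕ) z => ENNReal.ofReal (|vv m (infDist z.1 D) * f z.1 - vv m (infDist z.2 D) * f z.2| ^ p /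
        dist z.1 z.2 ^ ((n : ℝ) + s * p))) (f := fun _ => 0)
      (fun z => ENNReal.ofReal (2 ^ (p-1)) *
        (ENNReal.ofReal (|f z.1 - f z.2| ^ p / dist z.1 z.2 ^ ((n : ℝ) + s * p)) +
        ENNReal.ofReal (|f z.1| ^ p * ((min 1 (4 * dist z.1 z.2 / infDist z.1 D)) ^ p /
        dist z.1 z.2 ^ ((n : ℝ) + s * p))))) mF ?_ ?_ ?_
    · simp only [lintegral_zero] at this
      refine this.congr fun m => ?_
      exact lintegral_prod _ (mF m).aemeasurable
    · intro m
      filter_upwards [hae] with z hz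
      have := hd _ hz.1
      rw [← ENNReal.ofReal_add (by positivity) (by positivity), ← ENNReal.ofReal_mul (by positivity)]
      refine ENNReal.ofReal_le_ofReal ?_
      refine aux_dom p _ _ _ _ _ _ _ _ hp rfl (vv_nonneg _ _) (vv_le _ _) ?_ rfl (by positivity)
      refine vv_bound m _ _ _ this ?_
      have := (lipschitz_infDist_pt D).dist_le_mul z.1 z.2
      simpa [Real.dist_eq] using this
    · rw [lintegral_const_mul' _ _ ENNReal.ofReal_ne_top, lintegral_add_left mA,
        lintegral_prod _ mA.aemeasurable, lintegral_prod _ mB.aemeasurable]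
      exact ENNReal.mul_ne_top ENNReal.ofReal_ne_top (ENNReal.add_ne_top.2 ⟨hG2, hB⟩)
    · filter_upwards [hae] with z hz
      refine tendsto_const_nhds.congr' ?_
      filter_upwards [vv_eventually _ (hd _ hz.1), vv_eventually _ (hd _ hz.2)] with m hm hm2
      simp [hm, hm2, Real.zero_rpow hp0.ne']
  have c : Tendsto (fun t : ℝ≥0∞ => t ^ (1/p)) (nhds 0) (nhds 0) := by
    have := (ENNReal.continuous_rpow_const (y := 1/p)).tendsto 0
    rwa [ENNReal.zero_rpow_of_pos hip] at this
  have := (c.comp T1).add (c.comp T2)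
  rw [add_zero] at this
  exact this

/-- Under the `D`-adapted fractional Hardy inequality, the truncations
`f_m = (1 − v_m) f` converge to `f` in the intrinsic Gagliardo norm; in particular `f`
can be approximated by functions whose support has positive distance to `D`. -/
theorem stmt_7 {n : ℕ} (s p C₀ : ℝ) (hs : s ∈ Set.Ioo (0:ℝ) 1) (hp : 1 ≤ p)
    (hC₀ : 0 < C₀) (Ω D : Set (EuclideanSpace ℝ (Fin n)))
    (hΩopen : IsOpen Ω) (hΩconn : IsConnected Ω)
    (hD : IsClosed D) (hDsub : D ⊆ frontier Ω) (hDne : D.Nonempty)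
    (hardy : ∀ g : EuclideanSpace ℝ (Fin n) → ℝ, Measurable g →
      gagNorm n s p Ω g ≠ ⊤ →
      ∫⁻ x in Ω, ENNReal.ofReal (|g x| ^ p / infDist x D ^ (s * p)) ≤
        ENNReal.ofReal C₀ * (gagNorm n s p Ω g) ^ p)
    (f : EuclideanSpace ℝ (Fin n) → ℝ) (hf : Measurable f)
    (hfin : gagNorm n s p Ω f ≠ ⊤) :
    Tendsto (fun m : ℕ => gagNorm n s p Ω
      (fun x => f x - (1 - min 1 (max 0 (2 - (m : ℝ) * infDist x D))) * f x))
      atTop (nhds 0) ∧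
    ∀ ε : ℝ≥0∞, 0 < ε → ∃ g : EuclideanSpace ℝ (Fin n) → ℝ,
      (∃ δ : ℝ, 0 < δ ∧ ∀ x, infDist x D < δ → g x = 0) ∧
      gagNorm n s p Ω (fun x => f x - g x) < ε := by
  have hdisj : ∀ x ∈ Ω, x ∉ D := fun x hx hxD => by
    have := hDsub hxD
    rw [hΩopen.frontier_eq] at this
    exact this.2 hx
  have hd : ∀ x ∈ Ω, 0 < infDist x D := fun x hx =>
    (hD.notMem_iff_infDist_pos hDne).1 (hdisj x hx)
  have hn : n ≠ 0 := by
    rintro rfl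
    obtain ⟨x, hx⟩ := hΩconn.nonempty
    obtain ⟨y, hy⟩ := hDne
    exact hdisj x hx (Subsingleton.elim y x ▸ hy)
  have T := main_tendsto s p C₀ hs hp Ω D hΩopen hn hd hardy f hf hfin
  have e : ∀ m : ℕ, (fun x => f x - (1 - min 1 (max 0 (2 - (m : ℝ) * infDist x D))) * f x) =
      fun x => vv m (infDist x D) * f x := by
    intro m; funext x; unfold vv; ring
  have T' : Tendsto (fun m : ℕ => gagNorm n s p Ω
      (fun x => f x - (1 - min 1 (max 0 (2 - (m : ℝ) * infDist x D))) * f x))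
      atTop (nhds 0) := by
    simp_rw [e]; exact T
  refine ⟨T', fun ε hε => ?_⟩
  obtain ⟨m, hm, hm1⟩ := ((T'.eventually (gt_mem_nhds hε)).and (eventually_ge_atTop 1)).exists
  refine ⟨fun x => (1 - min 1 (max 0 (2 - (m : ℝ) * infDist x D))) * f x, ⟨1 / m, ?_, ?_⟩, hm⟩
  · have : (0:ℝ) < m := by exact_mod_cast hm1
    positivity
  · intro x hx
    have h0 : (0:ℝ) < m := by exact_mod_cast hm1
    rw [lt_div_iff₀ h0] at hx
    have : min 1 (max 0 (2 - (m : ℝ) * infDist x D)) = 1 :=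
      min_eq_left (le_max_of_le_right (by linarith))
    simp [this]
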